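/- Let T be a finite tree (a connected acyclic simple graph) that is not isomorphic to any path graph. Then Δ(T) ≤ res(T), and equality Δ(T) = res(T) holds if and only if T is isomorphic to the star K_{1,a} (the complete bipartite graph with parts of sizes 1 and a) with a = res(T) ≥ 3. -/

import Mathlib

open SimpleGraph

/-- A set `S` of vertices is a resolving set of `G` if every pair of distinct vertices
`x, y` is resolved by some vertex `u ∈ S`, i.e. `d(u,x) ≠ d(u,y)`. -/
def IsResolvingSet {V : Type*} (G : SimpleGraph V) (S : Set V) : Prop :=
  ∀ x y : V, x ≠ y → ∃ u ∈ S, G.dist u x ≠ G.dist u y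

/-- The resolving number of `G`: the minimum `k` such that every `k`-element subset of the
vertex set is a resolving set of `G`. -/
noncomputable def resolvingNumber {V : Type*} [Fintype V] (G : SimpleGraph V) : ℕ :=
  sInf {k | ∀ S : Finset V, S.card = k → IsResolvingSet G ↑S}

/-- A set of vertices that does not resolve some pair has fewer elements than the resolving
number. -/
theorem card_lt_resolvingNumber {V : Type*} [Fintype V] {G : SimpleGraph V} {S : Finset V}
    {x y : V} (hxy : x ≠ y) (hS : ∀ u ∈ S, G.dist u x = G.dist u y) :
    S.card < resolvingNumber G := by
  have hne : {k | ∀ S : Finset V, S.card = k → IsResolvingSet G ↑S}.Nonempty := by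
    refine ⟨Fintype.card V + 1, fun S hcard ↦ ?_⟩
    have := S.card_le_univ
    omega
  by_contra! hle
  obtain ⟨t, hts, ht⟩ := Finset.exists_subset_card_eq hle
  obtain ⟨u, hu, h⟩ := Nat.sInf_mem hne t ht x y hxy
  exact h (hS u (hts hu))

/-- A vertex at positive distance from `r` has a neighbour one step closer to `r`. -/
theorem SimpleGraph.Connected.exists_adj_dist_eq {V : Type*} {G : SimpleGraph V}
    (hG : G.Connected) {r v : V} {n : ℕ} (h : G.dist r v = n + 1) :
    ∃ u, G.Adj v u ∧ G.dist r u = n := by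
  obtain ⟨p, hp⟩ := hG.exists_walk_length_eq_dist v r
  rw [dist_comm, h] at hp
  cases p with
  | nil => simp at hp
  | @cons _ u _ hadj q =>
    refine ⟨u, hadj, ?_⟩
    have h₁ : G.dist u r ≤ q.length := dist_le q
    have h₂ : G.dist r v ≤ G.dist r u + G.dist u v := hG.dist_triangle
    rw [dist_eq_one_iff_adj.mpr hadj.symm] at h₂
    rw [dist_comm] at h₁
    simp only [Walk.length_cons] at hp
    omega

theorem SimpleGraph.Connected.dist_lt_card {V : Type*} [Fintype V] {G : SimpleGraph V}
    (hG : G.Connected) (u v : V) : G.dist u v < Fintype.card V := by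
  obtain ⟨p, hp, hlen⟩ := hG.exists_path_of_dist u v
  exact hlen ▸ hp.length_lt

/-- If all degrees are at most two, then the distance from a vertex of degree at most one
determines a vertex. -/
theorem SimpleGraph.Connected.dist_injective_of_degree_le_two {V : Type*} [Fintype V]
    {G : SimpleGraph V} [DecidableRel G.Adj] (hG : G.Connected) (hdeg : ∀ v, G.degree v ≤ 2)
    {r : V} (hr : G.degree r ≤ 1) : Function.Injective (G.dist r) := by
  classical
  suffices ∀ n v w, G.dist r v = n → G.dist r w = n → v = w from
    fun v w h ↦ this _ v w h rfl
  intro n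
  induction n with
  | zero =>
    intro v w hv hw
    rw [hG.dist_eq_zero_iff] at hv hw
    exact hv.symm.trans hw
  | succ n ih =>
    intro v w hv hw
    obtain ⟨u, hvu, hu⟩ := hG.exists_adj_dist_eq hv
    obtain ⟨u', hwu, hu'⟩ := hG.exists_adj_dist_eq hw
    obtain rfl := ih u u' hu hu'
    by_contra hne
    cases n with
    | zero =>
      obtain rfl := hG.dist_eq_zero_iff.mp hu
      have hsub : {v, w} ⊆ G.neighborFinset r := by
        intro z hz
        simp only [Finset.mem_insert, Finset.mem_singleton] at hz
        rcases hz with rfl | rfl <;> simp [hvu.symm, hwu.symm]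
      have := Finset.card_le_card hsub
      rw [Finset.card_pair hne, card_neighborFinset_eq_degree] at this
      omega
    | succ m =>
      obtain ⟨t, hut, ht⟩ := hG.exists_adj_dist_eq hu
      have hsub : {t, v, w} ⊆ G.neighborFinset u := by
        intro z hz
        simp only [Finset.mem_insert, Finset.mem_singleton] at hz
        rcases hz with rfl | rfl | rfl <;> simp [hvu.symm, hwu.symm, hut]
      have htv : t ≠ v := by rintro rfl; omega
      have htw : t ≠ w := by rintro rfl; omega
      have := Finset.card_le_card hsub
      rw [Finset.card_eq_three.mpr ⟨t, v, w, htv, htw, hne, rfl⟩,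
        card_neighborFinset_eq_degree] at this
      have := hdeg u
      omega

/-- A finite tree whose degrees are at most two is a path graph. -/
theorem SimpleGraph.IsTree.nonempty_iso_pathGraph {V : Type*} [Fintype V] {T : SimpleGraph V}
    [DecidableRel T.Adj] (hT : T.IsTree) (hdeg : ∀ v, T.degree v ≤ 2) :
    Nonempty (T ≃g pathGraph (Fintype.card V)) := by
  obtain ⟨r, hr⟩ : ∃ r, T.degree r ≤ 1 := by
    rcases subsingleton_or_nontrivial V with _ | _
    · obtain ⟨r⟩ := hT.connected.nonempty
      have := T.degree_le_maxDegree r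
      rw [maxDegree_of_subsingleton] at this
      exact ⟨r, by omega⟩
    · obtain ⟨r, hr⟩ := hT.exists_vert_degree_one_of_nontrivial
      exact ⟨r, hr.le⟩
  have hinj := hT.connected.dist_injective_of_degree_le_two hdeg hr
  let f : V → Fin (Fintype.card V) := fun v ↦ ⟨T.dist r v, hT.connected.dist_lt_card r v⟩
  have hf : Function.Bijective f := by
    rw [Fintype.bijective_iff_injective_and_card]
    exact ⟨fun v w h ↦ hinj (Fin.mk.inj h), by simp⟩
  refine ⟨Equiv.ofBijective f hf, fun {v w} ↦ ?_⟩
  rw [pathGraph_adj]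
  change T.dist r v + 1 = T.dist r w ∨ T.dist r w + 1 = T.dist r v ↔ T.Adj v w
  constructor
  · rintro (h | h)
    · obtain ⟨u, hu, hd⟩ := hT.connected.exists_adj_dist_eq h.symm
      exact hinj hd ▸ hu.symm
    · obtain ⟨u, hu, hd⟩ := hT.connected.exists_adj_dist_eq h.symm
      exact hinj hd ▸ hu
  · intro h
    have := hT.dist_eq_dist_add_one_of_adj r h
    omega

/-- A tree with a vertex adjacent to all others is a star. -/
theorem SimpleGraph.IsTree.nonempty_iso_star {V : Type*} [Fintype V] {T : SimpleGraph V}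
    [DecidableRel T.Adj] (hT : T.IsTree) {v : V} (hv : ∀ u, u = v ∨ T.Adj v u) :
    Nonempty (T ≃g completeBipartiteGraph (Fin 1) (Fin (T.degree v))) := by
  have hleaf : ∀ {x y}, T.Adj v x → T.Adj v y → ¬ T.Adj x y := fun hx hy hxy ↦
    hT.dist_ne_of_adj v hxy <| by
      rw [dist_eq_one_iff_adj.mpr hx, dist_eq_one_iff_adj.mpr hy]
  let e : Fin (T.degree v) ≃ T.neighborFinset v := (T.neighborFinset v).equivFin.symm
  have he : ∀ i, T.Adj v (e i) := fun i ↦ (T.mem_neighborFinset v _).mp (e i).2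
  let f : Fin 1 ⊕ Fin (T.degree v) → V := Sum.elim (fun _ ↦ v) (fun i ↦ e i)
  have hf : Function.Bijective f := by
    constructor
    · rintro (i | i) (j | j) h
      · rw [Subsingleton.elim i j]
      · exact ((he j).ne h).elim
      · exact ((he i).ne h.symm).elim
      · rw [e.injective (Subtype.ext h)]
    · intro u
      rcases hv u with rfl | hu
      · exact ⟨Sum.inl 0, rfl⟩
      · refine ⟨Sum.inr (e.symm ⟨u, by simpa using hu⟩), ?_⟩
        simp [f]
  refine ⟨RelIso.symm ⟨Equiv.ofBijective f hf, fun {a b} ↦ ?_⟩⟩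
  rcases a with i | i <;> rcases b with j | j
  · simp [f, completeBipartiteGraph]
  · simpa [f, completeBipartiteGraph] using he j
  · simpa [f, completeBipartiteGraph] using (he i).symm
  · simpa [f, completeBipartiteGraph] using hleaf (he i) (he j)

theorem SimpleGraph.IsTree.dist_eq_two {V : Type*} {T : SimpleGraph V} (hT : T.IsTree)
    {v z x : V} (hz : T.Adj v z) (hx : T.Adj v x) (hne : z ≠ x) : T.dist z x = 2 := by
  have h₁ := hT.dist_eq_dist_add_one_of_adj x hz
  rw [dist_comm, dist_comm (v := z), dist_eq_one_iff_adj.mpr hx] at h₁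
  have h₂ := hT.connected.pos_dist_of_ne hne
  omega

theorem SimpleGraph.IsTree.dist_eq_three {V : Type*} {T : SimpleGraph V} (hT : T.IsTree)
    {v w z x : V} (hz : T.Adj v z) (hw : T.Adj z w) (hwv : w ≠ v) (hx : T.Adj v x)
    (hne : z ≠ x) : T.dist w x = 3 := by
  have hzx := hT.dist_eq_two hz hx hne
  have hnadj : ¬ T.Adj z x := fun h ↦ by rw [dist_eq_one_iff_adj.mpr h] at hzx; omega
  have hwx : w ≠ x := by rintro rfl; exact hnadj hw
  have hp : (Walk.cons hw.symm (Walk.cons hz.symm (Walk.cons hx Walk.nil))).IsPath := by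
    simp [hwx, hwv, hne, hw.ne.symm, hz.ne.symm, hx.ne]
  obtain ⟨q, hq, hlen⟩ := hT.connected.exists_path_of_dist w x
  have := hT.isAcyclic.subsingleton_path w x
  have := congrArg (fun p : T.Path w x ↦ p.1.length) (Subsingleton.elim ⟨q, hq⟩ ⟨_, hp⟩)
  simpa [hlen] using this

theorem dist_eq_of_mem_insert_sdiff {V : Type*} [Fintype V] [DecidableEq V] {T : SimpleGraph V}
    [DecidableRel T.Adj] (hT : T.IsTree) {v x y : V} (hx : T.Adj v x) (hy : T.Adj v y) :
    ∀ u ∈ insert v (T.neighborFinset v \ {x, y}), T.dist u x = T.dist u y := by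
  intro u hu
  simp only [Finset.mem_insert, Finset.mem_sdiff, mem_neighborFinset, Finset.mem_singleton,
    not_or] at hu
  rcases hu with rfl | ⟨hu, hux, huy⟩
  · rw [dist_eq_one_iff_adj.mpr hx, dist_eq_one_iff_adj.mpr hy]
  · rw [hT.dist_eq_two hu hx hux, hT.dist_eq_two hu hy huy]

theorem card_insert_neighborFinset_sdiff {V : Type*} [Fintype V] [DecidableEq V]
    {T : SimpleGraph V} [DecidableRel T.Adj] {v x y : V} (hx : T.Adj v x) (hy : T.Adj v y)
    (hxy : x ≠ y) :
    (insert v (T.neighborFinset v \ {x, y})).card + 1 = T.degree v := by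
  have hsub : {x, y} ⊆ T.neighborFinset v := by
    intro z hz
    simp only [Finset.mem_insert, Finset.mem_singleton] at hz
    rcases hz with rfl | rfl <;> simp [hx, hy]
  have hcard := Finset.card_le_card hsub
  rw [Finset.card_pair hxy, card_neighborFinset_eq_degree] at hcard
  rw [Finset.card_insert_of_notMem (by simp), Finset.card_sdiff_of_subset hsub,
    Finset.card_pair hxy, card_neighborFinset_eq_degree]
  omega

theorem degree_le_resolvingNumber {V : Type*} [Fintype V] {T : SimpleGraph V}
    [DecidableRel T.Adj] (hT : T.IsTree) {v : V} (hv : 2 ≤ T.degree v) :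
    T.degree v ≤ resolvingNumber T := by
  classical
  obtain ⟨x, hx, y, hy, hxy⟩ := Finset.one_lt_card.mp hv
  rw [mem_neighborFinset] at hx hy
  have h₁ := card_lt_resolvingNumber hxy (dist_eq_of_mem_insert_sdiff hT hx hy)
  have h₂ := card_insert_neighborFinset_sdiff hx hy hxy
  omega

/-- A vertex at distance two from a vertex of degree at least three makes the resolving number
exceed that degree. -/
theorem degree_lt_resolvingNumber {V : Type*} [Fintype V] {T : SimpleGraph V}
    [DecidableRel T.Adj] (hT : T.IsTree) {v z w : V} (hv : 3 ≤ T.degree v) (hz : T.Adj v z)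
    (hw : T.Adj z w) (hwv : w ≠ v) : T.degree v < resolvingNumber T := by
  classical
  obtain ⟨x, hx, y, hy, hxy⟩ : ∃ x ∈ (T.neighborFinset v).erase z,
      ∃ y ∈ (T.neighborFinset v).erase z, x ≠ y := by
    apply Finset.one_lt_card.mp
    rw [Finset.card_erase_of_mem (by simpa using hz), card_neighborFinset_eq_degree]
    omega
  simp only [Finset.mem_erase, mem_neighborFinset] at hx hy
  have hwS : w ∉ insert v (T.neighborFinset v \ {x, y}) := by
    simp only [Finset.mem_insert, Finset.mem_sdiff, mem_neighborFinset, not_or, not_and]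
    refine ⟨hwv, fun h ↦ absurd h fun h ↦ hT.dist_ne_of_adj v hw ?_⟩
    rw [dist_eq_one_iff_adj.mpr hz, dist_eq_one_iff_adj.mpr h]
  have h₁ := card_lt_resolvingNumber (G := T)
    (S := insert w (insert v (T.neighborFinset v \ {x, y}))) hxy fun u hu ↦ by
      rcases Finset.mem_insert.mp hu with rfl | hu
      · rw [hT.dist_eq_three hz hw hwv hx.2 hx.1.symm, hT.dist_eq_three hz hw hwv hy.2 hy.1.symm]
      · exact dist_eq_of_mem_insert_sdiff hT hx.2 hy.2 u hu
  have h₂ := card_insert_neighborFinset_sdiff hx.2 hy.2 hxy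
  rw [Finset.card_insert_of_notMem hwS] at h₁
  omega

theorem maxDegree_star (a : ℕ)
    [DecidableRel (completeBipartiteGraph (Fin 1) (Fin a)).Adj] :
    (completeBipartiteGraph (Fin 1) (Fin a)).maxDegree = a := by
  classical
  apply le_antisymm
  · have : Nonempty (Fin 1 ⊕ Fin a) := ⟨Sum.inl 0⟩
    have := maxDegree_lt_card_verts (completeBipartiteGraph (Fin 1) (Fin a))
    simp only [Fintype.card_sum, Fintype.card_fin] at this
    omega
  · refine le_trans ?_ (degree_le_maxDegree _ (Sum.inl 0))
    have hsub : Finset.univ.map Function.Embedding.inr ⊆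
        (completeBipartiteGraph (Fin 1) (Fin a)).neighborFinset (Sum.inl 0) := by
      intro z hz
      obtain ⟨i, -, rfl⟩ := Finset.mem_map.mp hz
      simp
    simpa using Finset.card_le_card hsub

theorem stmt18 {V : Type*} [Fintype V] (T : SimpleGraph V) [DecidableRel T.Adj]
    (hT : T.IsTree) (hpath : ¬ ∃ n : ℕ, Nonempty (T ≃g pathGraph n)) :
    T.maxDegree ≤ resolvingNumber T ∧
      (T.maxDegree = resolvingNumber T ↔
        3 ≤ resolvingNumber T ∧
          Nonempty (T ≃g completeBipartiteGraph (Fin 1) (Fin (resolvingNumber T)))) := by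
  classical
  have := hT.connected.nonempty
  obtain ⟨v, hv⟩ := T.exists_maximal_degree_vertex
  have hdeg : 3 ≤ T.degree v := by
    by_contra! hlt
    refine hpath ⟨_, hT.nonempty_iso_pathGraph fun u ↦ ?_⟩
    have := T.degree_le_maxDegree u
    omega
  have hle := degree_le_resolvingNumber hT (v := v) (by omega)
  refine ⟨hv ▸ hle, fun heq ↦ ?_, fun ⟨h3, ⟨e⟩⟩ ↦ ?_⟩
  · rw [hv] at heq
    refine ⟨by omega, heq ▸ hT.nonempty_iso_star (v := v) fun u ↦ ?_⟩
    have hreach := (reachable_iff_reflTransGen v u).mp (hT.connected v u)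
    induction hreach with
    | refl => exact Or.inl rfl
    | tail _ hadj ih =>
      rcases ih with rfl | hz
      · exact Or.inr hadj
      · by_contra! hne
        exact (degree_lt_resolvingNumber hT hdeg hz hadj hne.1).ne heq
  · rw [e.maxDegree_eq, maxDegree_star]
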